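/- For every state ρ on C² ⊗ C², the entropic entanglement parameter satisfies M(ρ) ≤ 1 − S(ρ). -/

import Mathlib

open Matrix Kronecker BigOperators ComplexOrder

noncomputable section

namespace EEP

/-- `-(x * log₂ x)`; note `Real.logb 2 0 = 0`, giving the convention `0·log₂ 0 = 0`. -/
def negMulLog2 (x : ℝ) : ℝ := -(x * Real.logb 2 x)

/-- Shannon entropy (base 2) of a finite family of reals. -/
def shannon {n : Type*} [Fintype n] (p : n → ℝ) : ℝ := ∑ i, negMulLog2 (p i)

/-- A quantum state: positive semidefinite (hence Hermitian) matrix with trace 1. -/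
def IsState {n : Type*} [Fintype n] [DecidableEq n] (ρ : Matrix n n ℂ) : Prop :=
  ρ.PosSemidef ∧ ρ.trace = 1

/-- A rank-one orthogonal projection matrix. -/
def IsRankOneProj {n : Type*} [Fintype n] [DecidableEq n] (P : Matrix n n ℂ) : Prop :=
  P.IsHermitian ∧ P * P = P ∧ P.rank = 1

/-- A von Neumann measurement on `C^d ⊗ C^d`: a family of `d²` rank-one orthogonal
projections, mutually orthogonal, summing to the identity. -/
def IsMeasurement {d : ℕ} (P : Fin (d^2) → Matrix (Fin d × Fin d) (Fin d × Fin d) ℂ) : Prop :=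
  (∀ i, IsRankOneProj (P i)) ∧ (∀ i j, i ≠ j → P i * P j = 0) ∧ (∑ i, P i) = 1

/-- Klein entropy: Shannon entropy of the outcome distribution `pᵢ = Tr(ρ Pᵢ)`. -/
def kleinEntropy {d : ℕ} (ρ : Matrix (Fin d × Fin d) (Fin d × Fin d) ℂ)
    (P : Fin (d^2) → Matrix (Fin d × Fin d) (Fin d × Fin d) ℂ) : ℝ :=
  shannon (fun i => (ρ * P i).trace.re)

/-- A product state: Kronecker product of two states on `C^d`. -/
def IsProductState {d : ℕ} (δ : Matrix (Fin d × Fin d) (Fin d × Fin d) ℂ) : Prop :=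
  ∃ σA σB : Matrix (Fin d) (Fin d) ℂ, IsState σA ∧ IsState σB ∧ δ = σA ⊗ₖ σB

/-- Infimum of the Klein entropy over product states, for a fixed measurement. -/
def infProd {d : ℕ} (P : Fin (d^2) → Matrix (Fin d × Fin d) (Fin d × Fin d) ℂ) : ℝ :=
  sInf {x : ℝ | ∃ δ, IsProductState δ ∧ x = kleinEntropy δ P}

/-- The entropic entanglement parameter
`M(ρ) = sup_P ( inf_{δ product} H(δ,P) − H(ρ,P) )`. -/
def eep {d : ℕ} (ρ : Matrix (Fin d × Fin d) (Fin d × Fin d) ℂ) : ℝ :=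
  sSup {x : ℝ | ∃ P, IsMeasurement P ∧ x = infProd P - kleinEntropy ρ P}

/-- A separable state: finite convex combination of product states. -/
def IsSeparable {d : ℕ} (ρ : Matrix (Fin d × Fin d) (Fin d × Fin d) ℂ) : Prop :=
  ∃ (m : ℕ) (p : Fin m → ℝ) (δ : Fin m → Matrix (Fin d × Fin d) (Fin d × Fin d) ℂ),
    (∀ i, 0 ≤ p i) ∧ (∑ i, p i) = 1 ∧ (∀ i, IsProductState (δ i)) ∧
    ρ = ∑ i, (p i : ℂ) • δ i

/-- Rank-one projection `|v⟩⟨v|` onto a vector `v`. -/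
def projVec {n : Type*} (v : n → ℂ) : Matrix n n ℂ := Matrix.vecMulVec v (star v)

/-- Coefficient matrix `A` of a vector `ψ ∈ C^d ⊗ C^d`, `A i j = ψ (i,j)`. -/
def coeffMat {d : ℕ} (ψ : Fin d × Fin d → ℂ) : Matrix (Fin d) (Fin d) ℂ :=
  Matrix.of fun i j => ψ (i, j)

/-- The squared Schmidt coefficients of `ψ`: the eigenvalues of `A Aᴴ`
where `A` is the coefficient matrix of `ψ`. -/
def schmidtSq {d : ℕ} (ψ : Fin d × Fin d → ℂ) : Fin d → ℝ :=
  (Matrix.isHermitian_mul_conjTranspose_self (coeffMat ψ)).eigenvalues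

/-- Largest squared Schmidt coefficient (square of the largest singular value of `A`). -/
def maxSchmidtSq {d : ℕ} (ψ : Fin d × Fin d → ℂ) : ℝ := ⨆ i, schmidtSq ψ i

/-- A unit vector. -/
def IsUnitVec {n : Type*} [Fintype n] (ψ : n → ℂ) : Prop := (∑ p, Complex.normSq (ψ p)) = 1

/-- A maximally entangled unit vector: all squared Schmidt coefficients equal `1/d`. -/
def IsMaxEntVec {d : ℕ} (ψ : Fin d × Fin d → ℂ) : Prop :=
  IsUnitVec ψ ∧ ∀ i, schmidtSq ψ i = 1 / d

/-- A von Neumann measurement in a maximally entangled basis. -/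
def IsMaxEntMeasurement {d : ℕ}
    (P : Fin (d^2) → Matrix (Fin d × Fin d) (Fin d × Fin d) ℂ) : Prop :=
  IsMeasurement P ∧ ∀ i, ∃ ψ, IsMaxEntVec ψ ∧ P i = projVec ψ

/-- Von Neumann entropy: Shannon entropy of the eigenvalues. -/
def vnEntropy {n : Type*} [Fintype n] [DecidableEq n] {ρ : Matrix n n ℂ}
    (h : ρ.IsHermitian) : ℝ := shannon h.eigenvalues

/-- Binary Shannon entropy. -/
def binEnt (x : ℝ) : ℝ := negMulLog2 x + negMulLog2 (1 - x)


lemma negMulLog2_eq (x : ℝ) : negMulLog2 x = Real.negMulLog x / Real.log 2 := by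
  simp [negMulLog2, Real.negMulLog, Real.logb]; ring

lemma trace_rankOne {n : Type*} [Fintype n] [DecidableEq n] {P : Matrix n n ℂ}
    (h : IsRankOneProj P) : P.trace = 1 := by
  have hi : IsIdempotentElem (Matrix.toLin' P) := by
    unfold IsIdempotentElem
    rw [Module.End.mul_eq_comp, ← Matrix.toLin'_mul, h.2.1]
  have h2 := (LinearMap.IsIdempotentElem.isProj_range _ hi).trace
  rw [Matrix.trace_toLin'_eq] at h2
  rw [h2]
  have := h.2.2
  rw [Matrix.rank_eq_finrank_range_toLin P (Pi.basisFun ℂ n) (Pi.basisFun ℂ n)] at this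
  rw [Matrix.toLin_eq_toLin'] at this
  rw [this]; simp

lemma proj_posSemidef {n : Type*} [Fintype n] [DecidableEq n] {P : Matrix n n ℂ}
    (h : IsRankOneProj P) : P.PosSemidef := by
  have := Matrix.posSemidef_conjTranspose_mul_self P
  rwa [h.1.eq, h.2.1] at this

lemma entropy_ge (ρ : Matrix (Fin 2 × Fin 2) (Fin 2 × Fin 2) ℂ) (hρ : IsState ρ)
    (P : Fin (2^2) → Matrix (Fin 2 × Fin 2) (Fin 2 × Fin 2) ℂ) (hP : IsMeasurement P) :
    vnEntropy hρ.1.1 ≤ kleinEntropy ρ P := by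
  set l := hρ.1.1.eigenvalues with hl
  set U : Matrix (Fin 2 × Fin 2) (Fin 2 × Fin 2) ℂ := (hρ.1.1.eigenvectorUnitary).1 with hU
  have hUU : Uᴴ * U = 1 := by
    have := Unitary.coe_star_mul_self hρ.1.1.eigenvectorUnitary
    simpa [Matrix.star_eq_conjTranspose] using this
  have hUU' : U * Uᴴ = 1 := by
    have := Unitary.coe_mul_star_self hρ.1.1.eigenvectorUnitary
    simpa [Matrix.star_eq_conjTranspose] using this
  have hsp : ρ = U * diagonal (fun j => (l j : ℂ)) * Uᴴ := by
    have := hρ.1.1.spectral_theorem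
    rw [Unitary.conjStarAlgAut_apply] at this
    exact this
  let D : Fin (2^2) → (Fin 2 × Fin 2) → ℝ := fun i j => ((Uᴴ * P i * U) j j).re
  have hD0 : ∀ i j, 0 ≤ D i j := by
    intro i j
    have h := ((proj_posSemidef (hP.1 i)).conjTranspose_mul_mul_same U).diag_nonneg (i := j)
    exact (Complex.le_def.1 h).1
  have hDi : ∀ j, ∑ i, D i j = 1 := by
    intro j
    have : (∑ i, Uᴴ * P i * U) = 1 := by
      rw [← Finset.sum_mul, ← Finset.mul_sum, hP.2.2, Matrix.mul_one, hUU]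
    have h2 := congrArg (fun M => (M j j).re) this
    simpa [Matrix.sum_apply] using h2
  have hDj : ∀ i, ∑ j, D i j = 1 := by
    intro i
    have h1 : (Uᴴ * P i * U).trace = 1 := by
      rw [Matrix.trace_mul_comm, ← Matrix.mul_assoc, hUU', Matrix.one_mul, trace_rankOne (hP.1 i)]
    have h2 := congrArg Complex.re h1
    rw [Matrix.trace, Complex.re_sum] at h2
    simpa using h2
  have hp : ∀ i, (ρ * P i).trace.re = ∑ j, D i j * l j := by
    intro i
    have : (ρ * P i).trace = (diagonal (fun j => (l j : ℂ)) * (Uᴴ * P i * U)).trace := by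
      conv_lhs => rw [hsp]
      rw [Matrix.mul_assoc, Matrix.mul_assoc, Matrix.trace_mul_comm]
      simp only [Matrix.mul_assoc]
    rw [this, Matrix.trace, Complex.re_sum]
    refine Finset.sum_congr rfl fun j _ => ?_
    rw [Matrix.diag_apply, Matrix.diagonal_mul, Complex.re_ofReal_mul, mul_comm]
  have hl0 : ∀ j, 0 ≤ l j := fun j => hρ.1.eigenvalues_nonneg j
  have hlog : 0 < Real.log 2 := Real.log_pos (by norm_num)
  unfold vnEntropy kleinEntropy shannon
  simp only [negMulLog2_eq, ← Finset.sum_div]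
  refine div_le_div_of_nonneg_right ?_ hlog.le
  calc ∑ j, Real.negMulLog (l j) = ∑ j, (∑ i, D i j) * Real.negMulLog (l j) := by
        exact Finset.sum_congr rfl fun j _ => by rw [hDi j, one_mul]
    _ = ∑ i, ∑ j, D i j * Real.negMulLog (l j) := by
        simp only [Finset.sum_mul]; rw [Finset.sum_comm]
    _ ≤ ∑ i, Real.negMulLog (ρ * P i).trace.re := by
        refine Finset.sum_le_sum fun i _ => ?_
        rw [hp i]
        have := Real.concaveOn_negMulLog.le_map_sum (t := Finset.univ) (w := D i) (p := l)
          (fun j _ => hD0 i j) (hDj i) (fun j _ => hl0 j)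
        simpa [smul_eq_mul] using this

lemma exists_root (a b c : ℂ) : ∃ x y : ℂ, (x ≠ 0 ∨ y ≠ 0) ∧ a * x^2 + b * x * y + c * y^2 = 0 := by
  by_cases ha : a = 0
  · exact ⟨1, 0, by simp, by simp [ha]⟩
  · obtain ⟨s, hs⟩ := IsAlgClosed.exists_pow_nat_eq (discrim a b c) (n := 2) (by norm_num)
    obtain ⟨x, hx⟩ := exists_quadratic_eq_zero ha ⟨s, by rw [← hs]; ring⟩
    exact ⟨x, 1, by simp, by linear_combination hx⟩

lemma exists_fixed {n : Type*} [Fintype n] [DecidableEq n] {P : Matrix n n ℂ}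
    (h : IsRankOneProj P) : ∃ v, v ≠ 0 ∧ P *ᵥ v = v := by
  have hne : P ≠ 0 := by
    rintro rfl
    have := h.2.2
    simp at this
  obtain ⟨u, hu⟩ : ∃ u, P *ᵥ u ≠ 0 := by
    by_contra! hc
    exact hne (Matrix.ext_of_mulVec_single fun i => by rw [hc, Matrix.zero_mulVec])
  exact ⟨P *ᵥ u, hu, by rw [Matrix.mulVec_mulVec, h.2.1]⟩

lemma factor (w : Fin 2 × Fin 2 → ℂ)
    (hdet : w (0,0) * w (1,1) = w (0,1) * w (1,0)) :
    ∃ a b : Fin 2 → ℂ, ∀ i j, w (i,j) = a i * b j := by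
  by_cases h0 : w (0,0) = 0
  · by_cases h1 : w (0,1) = 0
    · exact ⟨![0,1], ![w (1,0), w (1,1)], by simp [Fin.forall_fin_two, h0, h1]⟩
    · have h2 : w (1,0) = 0 := by
        rw [h0, zero_mul] at hdet
        exact (mul_eq_zero.1 hdet.symm).resolve_left h1
      exact ⟨![w (0,1), w (1,1)], ![0,1], by simp [Fin.forall_fin_two, h0, h2]⟩
  · refine ⟨![1, w (1,0) / w (0,0)], ![w (0,0), w (0,1)], ?_⟩
    simp only [Fin.forall_fin_two]
    simp
    field_simp
    exact ⟨trivial, by linear_combination hdet⟩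

lemma state_of_vec (a : Fin 2 → ℂ) (ha : a ≠ 0) :
    IsState ((a ⬝ᵥ star a)⁻¹ • Matrix.vecMulVec a (star a)) := by
  have h0 : 0 ≤ a ⬝ᵥ star a := dotProduct_self_star_nonneg a
  have hne : a ⬝ᵥ star a ≠ 0 := fun h => ha (dotProduct_self_star_eq_zero.1 h)
  refine ⟨(Matrix.posSemidef_vecMulVec_self_star a).smul (inv_nonneg.2 h0), ?_⟩
  rw [Matrix.trace_smul, Matrix.trace_vecMulVec, smul_eq_mul, inv_mul_cancel₀ hne]

lemma exists_good (P : Fin (2^2) → Matrix (Fin 2 × Fin 2) (Fin 2 × Fin 2) ℂ)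
    (hP : IsMeasurement P) : ∃ δ, IsProductState δ ∧ kleinEntropy δ P ≤ 1 := by
  obtain ⟨u, hu0, hu⟩ := exists_fixed (hP.1 0)
  obtain ⟨v, hv0, hv⟩ := exists_fixed (hP.1 1)
  have hPu : ∀ k, k ≠ 0 → P k *ᵥ u = 0 := fun k hk => by
    rw [← hu, Matrix.mulVec_mulVec, hP.2.1 k 0 hk, Matrix.zero_mulVec]
  have hPv : ∀ k, k ≠ 1 → P k *ᵥ v = 0 := fun k hk => by
    rw [← hv, Matrix.mulVec_mulVec, hP.2.1 k 1 hk, Matrix.zero_mulVec]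
  obtain ⟨x, y, hxy, hq⟩ := exists_root (u (0,0) * u (1,1) - u (0,1) * u (1,0))
    (u (0,0) * v (1,1) + v (0,0) * u (1,1) - u (0,1) * v (1,0) - v (0,1) * u (1,0))
    (v (0,0) * v (1,1) - v (0,1) * v (1,0))
  set w : Fin 2 × Fin 2 → ℂ := x • u + y • v with hw
  have hPw : ∀ k, k ≠ 0 → k ≠ 1 → P k *ᵥ w = 0 := fun k h0 h1 => by
    rw [hw, Matrix.mulVec_add, Matrix.mulVec_smul, Matrix.mulVec_smul, hPu k h0, hPv k h1]; simp
  have hw0 : w ≠ 0 := by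
    intro h
    have h0 : P 0 *ᵥ w = x • u := by
      rw [hw, Matrix.mulVec_add, Matrix.mulVec_smul, Matrix.mulVec_smul, hu, hPv 0 (by decide)]; simp
    have h1 : P 1 *ᵥ w = y • v := by
      rw [hw, Matrix.mulVec_add, Matrix.mulVec_smul, Matrix.mulVec_smul, hv, hPu 1 (by decide)]; simp
    rw [h, Matrix.mulVec_zero] at h0 h1
    rcases hxy with hx | hy
    · exact (smul_ne_zero hx hu0) h0.symm
    · exact (smul_ne_zero hy hv0) h1.symm
  obtain ⟨a, b, hab⟩ := factor w (by
    simp only [hw, Pi.add_apply, Pi.smul_apply, smul_eq_mul]; linear_combination hq)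
  have ha : a ≠ 0 := by
    rintro rfl; exact hw0 (by ext ⟨i, j⟩; simp [hab])
  have hb : b ≠ 0 := by
    rintro rfl; exact hw0 (by ext ⟨i, j⟩; simp [hab])
  have hsa := state_of_vec a ha
  have hsb := state_of_vec b hb
  set σA := ((a ⬝ᵥ star a)⁻¹ • Matrix.vecMulVec a (star a)) with hA
  set σB := ((b ⬝ᵥ star b)⁻¹ • Matrix.vecMulVec b (star b)) with hB
  refine ⟨σA ⊗ₖ σB, ⟨σA, σB, hsa, hsb, rfl⟩, ?_⟩
  have hδ : σA ⊗ₖ σB = ((a ⬝ᵥ star a)⁻¹ * (b ⬝ᵥ star b)⁻¹) • Matrix.vecMulVec w (star w) := by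
    ext ⟨i, j⟩ ⟨k, l⟩
    simp only [hA, hB, Matrix.kroneckerMap_apply, Matrix.smul_apply, Matrix.vecMulVec_apply,
      Pi.star_apply, hab, smul_eq_mul, star_mul']
    ring
  set δ := σA ⊗ₖ σB with hδd
  set p : Fin (2^2) → ℝ := fun i => (δ * P i).trace.re with hp
  have hpk : ∀ k, k ≠ 0 → k ≠ 1 → p k = 0 := fun k h0 h1 => by
    have : (δ * P k).trace = 0 := by
      rw [Matrix.trace_mul_comm, hδ, Matrix.mul_smul, Matrix.mul_vecMulVec, hPw k h0 h1]; simp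
    simp [hp, this]
  have hsum : ∑ k, p k = 1 := by
    have : ∑ k, (δ * P k).trace = 1 := by
      rw [← Matrix.trace_sum, ← Finset.mul_sum, hP.2.2, Matrix.mul_one, hδd,
        Matrix.trace_kronecker, hsa.2, hsb.2, one_mul]
    have h2 := congrArg Complex.re this
    rw [Complex.re_sum] at h2
    simpa using h2
  have h2 : p (2 : Fin 4) = 0 := hpk (2 : Fin 4) (by decide) (by decide)
  have h3 : p (3 : Fin 4) = 0 := hpk (3 : Fin 4) (by decide) (by decide)
  have hs : p (0 : Fin 4) + p (1 : Fin 4) = 1 := by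
    have : ∑ k : Fin 4, p k = 1 := hsum
    rw [Fin.sum_univ_four, h2, h3] at this
    linarith
  have hlog : 0 < Real.log 2 := Real.log_pos (by norm_num)
  have key : kleinEntropy δ P = ∑ k : Fin 4, negMulLog2 (p k) := rfl
  rw [key, Fin.sum_univ_four, h2, h3]
  have h1 : p (1 : Fin 4) = 1 - p (0 : Fin 4) := by linarith
  rw [h1]
  simp only [negMulLog2_eq, Real.negMulLog_zero, zero_div, add_zero]
  rw [← add_div, ← Real.binEntropy_eq_negMulLog_add_negMulLog_one_sub, div_le_one hlog]
  exact Real.binEntropy_le_log_two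

lemma trace_mul_nonneg {n : Type*} [Fintype n] [DecidableEq n] {A P : Matrix n n ℂ}
    (hA : A.PosSemidef) (h : IsRankOneProj P) : 0 ≤ (A * P).trace.re := by
  have h1 : (A * P).trace = (Pᴴ * A * P).trace := by
    rw [h.1.eq, Matrix.trace_mul_comm (P * A) P, ← Matrix.mul_assoc, h.2.1,
      Matrix.trace_mul_comm]
  rw [h1]
  exact (Complex.le_def.1 (hA.conjTranspose_mul_mul_same P).trace_nonneg).1

lemma klein_nonneg (δ : Matrix (Fin 2 × Fin 2) (Fin 2 × Fin 2) ℂ) (hd : IsState δ)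
    (P : Fin (2^2) → Matrix (Fin 2 × Fin 2) (Fin 2 × Fin 2) ℂ) (hP : IsMeasurement P) :
    0 ≤ kleinEntropy δ P := by
  have h0 : ∀ i, 0 ≤ (δ * P i).trace.re := fun i => trace_mul_nonneg hd.1 (hP.1 i)
  have hsum : ∑ k, (δ * P k).trace.re = 1 := by
    have : ∑ k, (δ * P k).trace = 1 := by
      rw [← Matrix.trace_sum, ← Finset.mul_sum, hP.2.2, Matrix.mul_one, hd.2]
    have h2 := congrArg Complex.re this
    rw [Complex.re_sum] at h2
    simpa using h2
  have hlog : 0 < Real.log 2 := Real.log_pos (by norm_num)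
  unfold kleinEntropy shannon
  refine Finset.sum_nonneg fun i _ => ?_
  rw [negMulLog2_eq]
  refine div_nonneg (Real.negMulLog_nonneg (h0 i) ?_) hlog.le
  rw [← hsum]
  exact Finset.single_le_sum (f := fun k => (δ * P k).trace.re) (fun k _ => h0 k)
    (Finset.mem_univ i)

lemma infProd_le (P : Fin (2^2) → Matrix (Fin 2 × Fin 2) (Fin 2 × Fin 2) ℂ)
    (hP : IsMeasurement P) : infProd P ≤ 1 := by
  obtain ⟨δ, hδ, hle⟩ := exists_good P hP
  have hbdd : BddBelow {x : ℝ | ∃ δ, IsProductState δ ∧ x = kleinEntropy δ P} := ⟨0, ?_⟩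
  · exact (csInf_le hbdd ⟨δ, hδ, rfl⟩).trans hle
  rintro x ⟨δ', ⟨A, B, hA, hB, rfl⟩, rfl⟩
  exact klein_nonneg _ ⟨hA.1.kronecker hB.1, by
    rw [Matrix.trace_kronecker, hA.2, hB.2, one_mul]⟩ P hP

lemma exists_measurement : ∃ P : Fin (2^2) → Matrix (Fin 2 × Fin 2) (Fin 2 × Fin 2) ℂ,
    IsMeasurement P := by
  let e : Fin (2^2) ≃ Fin 2 × Fin 2 := Fintype.equivOfCardEq (by simp)
  refine ⟨fun i => Matrix.single (e i) (e i) 1, fun i => ⟨?_, ?_, ?_⟩, fun i j hij => ?_, ?_⟩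
  · simp [Matrix.IsHermitian]
  · simp
  · have h1 : Matrix.single (e i) (e i) (1:ℂ)
        = Matrix.vecMulVec (Pi.single (e i) 1) (Pi.single (e i) 1) :=
      Matrix.single_eq_single_vecMulVec_single _ _
    have hle : (Matrix.single (e i) (e i) (1:ℂ)).rank ≤ 1 := by
      rw [h1]; exact Matrix.rank_vecMulVec_le _ _
    have hne : (Matrix.single (e i) (e i) (1:ℂ)).rank ≠ 0 := by
      intro h
      rw [Matrix.rank, Submodule.finrank_eq_zero, LinearMap.range_eq_bot] at h
      have := congrFun (congrArg (fun f => f (Pi.single (e i) 1)) h) (e i)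
      simp at this
    show (Matrix.single (e i) (e i) (1:ℂ)).rank = 1
    omega
  · simp [Matrix.single_mul_single_of_ne, e.injective.ne hij]
  · rw [Equiv.sum_comp e (fun j => Matrix.single j j (1:ℂ))]
    ext a b
    by_cases hab : a = b
    · subst hab; simp [Matrix.sum_apply, Matrix.single_apply]
    · rw [Matrix.sum_apply, Matrix.one_apply_ne hab]
      refine Finset.sum_eq_zero fun x _ => ?_
      rw [Matrix.single_apply, if_neg]
      rintro ⟨rfl, h⟩
      exact hab h

/-- For every state ρ on C² ⊗ C², M(ρ) ≤ 1 − S(ρ). -/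
theorem stmt6 (ρ : Matrix (Fin 2 × Fin 2) (Fin 2 × Fin 2) ℂ) (hρ : IsState ρ) :
    eep ρ ≤ 1 - vnEntropy hρ.1.1 := by
  unfold eep
  obtain ⟨P₀, hP₀⟩ := exists_measurement
  refine csSup_le ⟨_, P₀, hP₀, rfl⟩ ?_
  rintro x ⟨P, hP, rfl⟩
  have h1 := infProd_le P hP
  have h2 := entropy_ge ρ hρ P hP
  linarith

end EEP
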